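/- Let R = P/Q be a non-constant rational function, with P, Q ∈ ℂ[X] coprime, Q ≠ 0 and max(deg P, deg Q) ≥ 1. Then R and R' share the value 0 on the sphere ℂ∪{∞} — that is, for every z ∈ ℂ with Q(z) ≠ 0 one has P(z) = 0 ⇔ P'(z)·Q(z) − P(z)·Q'(z) = 0, and moreover deg P < deg Q ⇔ deg(P'·Q − P·Q') < 2·deg Q — if and only if there exist c ∈ ℂ∖{0}, A ∈ ℂ and an integer n with n ∉ {0, 1} such that for every z ∈ ℂ with Q(z) ≠ 0 and z ≠ A one has P(z)/Q(z) = c·(z − A)^n. -/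

import Mathlib

open Polynomial

namespace Polynomial

lemma rootMultiplicity_derivative_mul_sub_mul_derivative {P Q : ℂ[X]} {a : ℂ} (hP0 : P ≠ 0)
    (hP : P.eval a = 0) (hQ : Q.eval a ≠ 0) :
    rootMultiplicity a (derivative P * Q - P * derivative Q) = rootMultiplicity a P - 1 := by
  obtain ⟨P₁, hP₁, hdvd⟩ := exists_eq_pow_rootMultiplicity_mul_and_not_dvd P hP0 a
  have hpos : 0 < rootMultiplicity a P := (rootMultiplicity_pos hP0).2 hP
  obtain ⟨m, hm⟩ : ∃ m, rootMultiplicity a P = m + 1 := ⟨_, (Nat.succ_pred_eq_of_pos hpos).symm⟩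
  rw [hm] at hP₁ ⊢
  have hP₁a : P₁.eval a ≠ 0 := fun h => hdvd (dvd_iff_isRoot.2 h)
  have hW : derivative P * Q - P * derivative Q =
      (C ((m : ℂ) + 1) * P₁ * Q + (X - C a) * (derivative P₁ * Q - P₁ * derivative Q)) *
        (X - C a) ^ m := by
    rw [hP₁, derivative_mul, derivative_X_sub_C_pow]
    simp only [Nat.add_sub_cancel, C_add, C_1, map_natCast, Nat.cast_add, Nat.cast_one]
    ring
  have hne : (C ((m : ℂ) + 1) * P₁ * Q +
      (X - C a) * (derivative P₁ * Q - P₁ * derivative Q)).eval a ≠ 0 := by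
    simp only [eval_add, eval_mul, eval_C, eval_sub, eval_X, sub_self, zero_mul, add_zero]
    exact mul_ne_zero (mul_ne_zero (Nat.cast_add_one_ne_zero m) hP₁a) hQ
  have hne0 : C ((m : ℂ) + 1) * P₁ * Q +
      (X - C a) * (derivative P₁ * Q - P₁ * derivative Q) ≠ 0 := by
    intro h
    rw [h] at hne
    exact hne eval_zero
  rw [hW, rootMultiplicity_mul_X_sub_C_pow hne0, rootMultiplicity_eq_zero hne]
  simp

lemma roots_derivative_mul_sub_mul_derivative {P Q : ℂ[X]} (hPQ : IsCoprime P Q) (hP : P ≠ 0)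
    (hQ : Q ≠ 0)
    (h : ∀ z, P.eval z ≠ 0 → Q.eval z ≠ 0 → (derivative P * Q - P * derivative Q).eval z ≠ 0) :
    (derivative P * Q - P * derivative Q).roots = (P * Q).roots - (P * Q).roots.dedup := by
  ext a
  rw [Multiset.count_sub, Multiset.count_dedup, count_roots, count_roots,
    rootMultiplicity_mul (mul_ne_zero hP hQ)]
  simp only [mem_roots (mul_ne_zero hP hQ), IsRoot.def, eval_mul]
  by_cases hPa : P.eval a = 0
  · have hQa : Q.eval a ≠ 0 := by
      obtain ⟨u, v, huv⟩ := hPQ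
      intro hQa
      simpa [hPa, hQa] using congrArg (eval a) huv
    rw [rootMultiplicity_derivative_mul_sub_mul_derivative hP hPa hQa, rootMultiplicity_eq_zero hQa]
    simp [hPa]
  · by_cases hQa : Q.eval a = 0
    · have hneg : derivative P * Q - P * derivative Q =
          C (-1) * (derivative Q * P - Q * derivative P) := by
        simp only [C_neg, C_1]
        ring
      rw [hneg, ← count_roots, roots_C_mul _ (by norm_num), count_roots,
        rootMultiplicity_derivative_mul_sub_mul_derivative hQ hQa hPa, rootMultiplicity_eq_zero hPa]
      simp [hQa]
    · rw [rootMultiplicity_eq_zero (h a hPa hQa), rootMultiplicity_eq_zero hPa,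
        rootMultiplicity_eq_zero hQa]
      simp

lemma natDegree_X_mul_derivative_le (P : ℂ[X]) : (X * derivative P).natDegree ≤ P.natDegree := by
  rw [natDegree_le_iff_coeff_eq_zero]
  rintro (_ | n) hn
  · simp
  · rw [coeff_X_mul, coeff_derivative, coeff_eq_zero_of_natDegree_lt hn, zero_mul]

lemma coeff_X_mul_derivative (P : ℂ[X]) (n : ℕ) : (X * derivative P).coeff n = n * P.coeff n := by
  cases n with
  | zero => simp
  | succ n => rw [coeff_X_mul, coeff_derivative]; push_cast; ring

lemma X_mul_derivative_mul_sub_mul_derivative (P Q : ℂ[X]) :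
    X * (derivative P * Q - P * derivative Q) =
      X * derivative P * Q - P * (X * derivative Q) := by ring

lemma natDegree_X_mul_derivative_mul_sub_mul_derivative_le (P Q : ℂ[X]) :
    (X * (derivative P * Q - P * derivative Q)).natDegree ≤ P.natDegree + Q.natDegree := by
  rw [X_mul_derivative_mul_sub_mul_derivative]
  rw [← max_self (P.natDegree + Q.natDegree)]
  exact natDegree_sub_le_of_le
    (natDegree_mul_le_of_le (natDegree_X_mul_derivative_le P) le_rfl)
    (natDegree_mul_le_of_le le_rfl (natDegree_X_mul_derivative_le Q))

lemma coeff_X_mul_derivative_mul_sub_mul_derivative (P Q : ℂ[X]) :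
    (X * (derivative P * Q - P * derivative Q)).coeff (P.natDegree + Q.natDegree) =
      ((P.natDegree : ℂ) - Q.natDegree) * (P.leadingCoeff * Q.leadingCoeff) := by
  rw [X_mul_derivative_mul_sub_mul_derivative, coeff_sub,
    coeff_mul_add_eq_of_natDegree_le (natDegree_X_mul_derivative_le P) le_rfl,
    coeff_mul_add_eq_of_natDegree_le le_rfl (natDegree_X_mul_derivative_le Q),
    coeff_X_mul_derivative, coeff_X_mul_derivative, leadingCoeff, leadingCoeff]
  ring

lemma natDegree_derivative_mul_sub_mul_derivative_add_one {P Q : ℂ[X]} (hP : P ≠ 0) (hQ : Q ≠ 0)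
    (h : P.natDegree ≠ Q.natDegree) :
    (derivative P * Q - P * derivative Q).natDegree + 1 = P.natDegree + Q.natDegree := by
  have hc : (X * (derivative P * Q - P * derivative Q)).coeff (P.natDegree + Q.natDegree) ≠ 0 := by
    rw [coeff_X_mul_derivative_mul_sub_mul_derivative]
    exact mul_ne_zero (sub_ne_zero.2 (by exact_mod_cast h))
      (mul_ne_zero (leadingCoeff_ne_zero.2 hP) (leadingCoeff_ne_zero.2 hQ))
  have hW : derivative P * Q - P * derivative Q ≠ 0 := by
    intro h0
    simp [h0] at hc
  rw [← natDegree_X_mul hW]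
  exact le_antisymm (natDegree_X_mul_derivative_mul_sub_mul_derivative_le P Q)
    (le_natDegree_of_ne_zero hc)

lemma degree_derivative_mul_sub_mul_derivative_lt {P Q : ℂ[X]} (hP : P ≠ 0) (hQ : Q ≠ 0) :
    (derivative P * Q - P * derivative Q).degree < P.degree + Q.degree := by
  rw [degree_eq_natDegree hP, degree_eq_natDegree hQ, ← Nat.cast_add]
  by_cases hW : derivative P * Q - P * derivative Q = 0
  · rw [hW, degree_zero]
    exact WithBot.bot_lt_coe _
  · have hle := natDegree_X_mul_derivative_mul_sub_mul_derivative_le P Q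
    rw [natDegree_X_mul hW] at hle
    rw [degree_eq_natDegree hW]
    exact_mod_cast hle

lemma eq_C_mul_X_sub_C_pow_of_forall_root_eq {P : ℂ[X]} {A : ℂ} (hP : P ≠ 0)
    (h : ∀ z, P.eval z = 0 → z = A) : P = C P.leadingCoeff * (X - C A) ^ P.natDegree := by
  have hs := IsAlgClosed.splits P
  have hr : P.roots = Multiset.replicate P.natDegree A :=
    Multiset.eq_replicate.2 ⟨hs.natDegree_eq_card_roots.symm, fun z hz => h z ((mem_roots hP).1 hz)⟩
  conv_lhs => rw [hs.eq_prod_roots, hr]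
  simp

end Polynomial

lemma exists_zpow_of_shares_zero {P Q : ℂ[X]} (hPQ : IsCoprime P Q) (hQ : Q ≠ 0)
    (hd : 1 ≤ max P.natDegree Q.natDegree)
    (h : ∀ z : ℂ, Q.eval z ≠ 0 →
        (P.eval z = 0 ↔ (derivative P * Q - P * derivative Q).eval z = 0))
    (h_inf : P.degree < Q.degree ↔
        (derivative P * Q - P * derivative Q).degree < Q.degree + Q.degree) :
    ∃ (c A : ℂ) (n : ℤ), c ≠ 0 ∧ n ≠ 0 ∧ n ≠ 1 ∧
        ∀ z : ℂ, Q.eval z ≠ 0 → z ≠ A → P.eval z / Q.eval z = c * (z - A) ^ n := by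
  have hP : P ≠ 0 := by
    rintro rfl
    rw [natDegree_eq_zero_of_isUnit (isCoprime_zero_left.1 hPQ)] at hd
    simp at hd
  have hdeg : P.natDegree ≠ Q.natDegree := by
    intro he
    have he' : P.degree = Q.degree := by
      rw [degree_eq_natDegree hP, degree_eq_natDegree hQ, he]
    have hlt := degree_derivative_mul_sub_mul_derivative_lt hP hQ
    rw [he', ← h_inf, he'] at hlt
    exact lt_irrefl _ hlt
  have hroots := congrArg Multiset.card
    (roots_derivative_mul_sub_mul_derivative hPQ hP hQ fun z hPz hQz => (h z hQz).not.1 hPz)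
  rw [Multiset.card_sub (Multiset.dedup_le _),
    ← (IsAlgClosed.splits (derivative P * Q - P * derivative Q)).natDegree_eq_card_roots,
    ← (IsAlgClosed.splits (P * Q)).natDegree_eq_card_roots, natDegree_mul hP hQ] at hroots
  have hcard : Multiset.card (P * Q).roots.dedup = 1 := by
    have := natDegree_derivative_mul_sub_mul_derivative_add_one hP hQ hdeg
    have hle := Multiset.card_le_card (Multiset.dedup_le (P * Q).roots)
    rw [← (IsAlgClosed.splits (P * Q)).natDegree_eq_card_roots, natDegree_mul hP hQ] at hle
    omega
  obtain ⟨A, hA⟩ := Multiset.card_eq_one.1 hcard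
  have hroot : ∀ z, (P * Q).eval z = 0 → z = A := fun z hz => by
    rw [← Multiset.mem_singleton, ← hA, Multiset.mem_dedup]
    exact (mem_roots (mul_ne_zero hP hQ)).2 hz
  have hPA := eq_C_mul_X_sub_C_pow_of_forall_root_eq hP fun z hz => hroot z (by simp [hz])
  have hQA := eq_C_mul_X_sub_C_pow_of_forall_root_eq hQ fun z hz => hroot z (by simp [hz])
  have ha := leadingCoeff_ne_zero.2 hP
  have hb := leadingCoeff_ne_zero.2 hQ
  refine ⟨P.leadingCoeff / Q.leadingCoeff, A, P.natDegree - Q.natDegree, div_ne_zero ha hb,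
    by omega, ?_, ?_⟩
  · intro hn
    have hPz : P.eval A = 0 := by
      rw [hPA]
      simp [show P.natDegree ≠ 0 by omega]
    have hQz : Q.eval A ≠ 0 := by
      obtain ⟨u, v, huv⟩ := hPQ
      intro hQz
      simpa [hPz, hQz] using congrArg (eval A) huv
    have hq : Q.natDegree = 0 := by
      by_contra hq
      rw [hQA] at hQz
      simp [hq] at hQz
    have hp : P.natDegree = 1 := by omega
    have hW := (h A hQz).1 hPz
    rw [hp, pow_one] at hPA
    rw [eval_sub, eval_mul, eval_mul, hPz, hPA] at hW
    simp [hP, hQz] at hW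
  · intro z _ hz
    have hz' := sub_ne_zero.2 hz
    conv_lhs => rw [hPA, hQA]
    rw [zpow_sub₀ hz', zpow_natCast, zpow_natCast]
    simp only [eval_mul, eval_C, eval_pow, eval_sub, eval_X]
    rw [mul_div_mul_comm]

lemma shares_zero_of_pow {c A b : ℂ} {m : ℕ} (hc : c ≠ 0) (hb : b ≠ 0) (hm : 2 ≤ m) {P Q : ℂ[X]}
    (hP : P = C c * (X - C A) ^ m) (hQ : Q = C b) :
    (∀ z : ℂ, Q.eval z ≠ 0 →
        (P.eval z = 0 ↔ (derivative P * Q - P * derivative Q).eval z = 0)) ∧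
      (P.degree < Q.degree ↔
        (derivative P * Q - P * derivative Q).degree < Q.degree + Q.degree) := by
  have hW : derivative P * Q - P * derivative Q = C (c * m * b) * (X - C A) ^ (m - 1) := by
    rw [hP, hQ, derivative_C_mul, derivative_X_sub_C_pow, derivative_C]
    simp only [C_mul, map_natCast]
    ring
  have hm0 : (m : ℂ) ≠ 0 := Nat.cast_ne_zero.2 (by omega)
  have hk := mul_ne_zero (mul_ne_zero hc hm0) hb
  rw [hW]
  refine ⟨fun z _ => ?_, ?_⟩
  · simp [hP, hc, hb, hm0, show m ≠ 0 by omega, show m - 1 ≠ 0 by omega]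
  · rw [hP, hQ, degree_C_mul hc, degree_C_mul hk, degree_C hb, degree_pow, degree_pow,
      degree_X_sub_C, nsmul_one, nsmul_one, add_zero]
    norm_cast
    omega

lemma shares_zero_of_inv_pow {a A b : ℂ} {m : ℕ} (ha : a ≠ 0) (hb : b ≠ 0) (hm : 1 ≤ m)
    {P Q : ℂ[X]} (hP : P = C a) (hQ : Q = C b * (X - C A) ^ m) :
    (∀ z : ℂ, Q.eval z ≠ 0 →
        (P.eval z = 0 ↔ (derivative P * Q - P * derivative Q).eval z = 0)) ∧
      (P.degree < Q.degree ↔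
        (derivative P * Q - P * derivative Q).degree < Q.degree + Q.degree) := by
  have hW : derivative P * Q - P * derivative Q = C (-(a * m * b)) * (X - C A) ^ (m - 1) := by
    rw [hP, hQ, derivative_C_mul, derivative_X_sub_C_pow, derivative_C]
    simp only [C_mul, C_neg, map_natCast]
    ring
  have hm0 : (m : ℂ) ≠ 0 := Nat.cast_ne_zero.2 (by omega)
  have hk := neg_ne_zero.2 (mul_ne_zero (mul_ne_zero ha hm0) hb)
  rw [hW]
  refine ⟨fun z hz => ?_, ?_⟩
  · have hzA : z - A ≠ 0 := by
      intro h
      simp [hQ, h, show m ≠ 0 by omega] at hz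
    simp [hP, ha, hb, hm0, hzA]
  · rw [hP, hQ, degree_C_mul hb, degree_C_mul hk, degree_C ha, degree_pow, degree_pow,
      degree_X_sub_C, nsmul_one, nsmul_one]
    norm_cast
    omega

lemma Polynomial.eq_of_forall_eval_eq_of_ne {F G Q : ℂ[X]} {A : ℂ} (hQ : Q ≠ 0)
    (h : ∀ z, Q.eval z ≠ 0 → z ≠ A → F.eval z = G.eval z) : F = G := by
  have h0 : (F - G) * (Q * (X - C A)) = 0 := by
    refine Polynomial.funext fun z => ?_
    by_cases hQz : Q.eval z = 0
    · simp [hQz]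
    by_cases hz : z = A
    · simp [hz]
    simp [h z hQz hz]
  exact sub_eq_zero.1 ((mul_eq_zero.1 h0).resolve_right (mul_ne_zero hQ (X_sub_C_ne_zero A)))

/-- A non-constant rational function `R = P/Q` shares the value `0` with its derivative
on the sphere `ℂ∪{∞}` if and only if `R(z) = c·(z − A)^n` with `c ≠ 0` and an integer
`n ∉ {0, 1}`. -/
theorem rational_shares_zero_on_sphere_iff
    (P Q : ℂ[X]) (hPQ : IsCoprime P Q) (hQ : Q ≠ 0)
    (hd : 1 ≤ max P.natDegree Q.natDegree) :
    ((∀ z : ℂ, Q.eval z ≠ 0 →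
        (P.eval z = 0 ↔ (derivative P * Q - P * derivative Q).eval z = 0)) ∧
      (P.degree < Q.degree ↔
        (derivative P * Q - P * derivative Q).degree < Q.degree + Q.degree)) ↔
      ∃ (c A : ℂ) (n : ℤ), c ≠ 0 ∧ n ≠ 0 ∧ n ≠ 1 ∧
        ∀ z : ℂ, Q.eval z ≠ 0 → z ≠ A →
          P.eval z / Q.eval z = c * (z - A) ^ n := by
  refine ⟨fun h => exists_zpow_of_shares_zero hPQ hQ hd h.1 h.2, ?_⟩
  rintro ⟨c, A, n, hc, hn0, hn1, h⟩
  obtain ⟨m, rfl | rfl⟩ := n.eq_nat_or_neg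
  · have hPeq : P = C c * (X - C A) ^ m * Q := by
      refine eq_of_forall_eval_eq_of_ne (A := A) hQ fun z hQz hz => ?_
      have := (div_eq_iff hQz).1 (h z hQz hz)
      simpa using this
    obtain ⟨b, hb, rfl⟩ := isUnit_iff.1 (hPQ.isUnit_of_dvd' (Dvd.intro_left _ hPeq.symm) dvd_rfl)
    refine shares_zero_of_pow (mul_ne_zero hc hb.ne_zero) hb.ne_zero (m := m) (A := A)
      (by omega) ?_ rfl
    rw [hPeq, C_mul]
    ring
  · have hQeq : Q = C c⁻¹ * (X - C A) ^ m * P := by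
      refine eq_of_forall_eval_eq_of_ne (A := A) hQ fun z hQz hz => ?_
      have hz' := pow_ne_zero m (sub_ne_zero.2 hz)
      have := h z hQz hz
      rw [zpow_neg, zpow_natCast] at this
      field_simp at this
      simp only [eval_mul, eval_C, eval_pow, eval_sub, eval_X]
      field_simp
      linear_combination -this
    obtain ⟨a, ha, rfl⟩ := isUnit_iff.1 (hPQ.isUnit_of_dvd' dvd_rfl (Dvd.intro_left _ hQeq.symm))
    refine shares_zero_of_inv_pow ha.ne_zero (mul_ne_zero (inv_ne_zero hc) ha.ne_zero) (m := m)
      (A := A) (by omega) rfl ?_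
    rw [hQeq, C_mul]
    ring
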